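/- Let K be an imaginary quadratic field of discriminant D, and let N ≥ 1 and c ≥ 1 be integers with gcd(c, N) = 1. Assume that no prime divisor of N is inert in K (i.e. for every prime p | N, the ideal p𝒪_K is not prime), and that every prime p with p² | N splits in K (i.e. p𝒪_K is a product of two distinct prime ideals). Then there exist integers a and b with gcd(N, a, b) = 1 and a² − 4Nb = Dc². -/

import Mathlib

/-!
Statement 14: if `K` is an imaginary quadratic field of discriminant `D`,
`N, c ≥ 1` with `gcd(c,N) = 1`, no prime divisor of `N` is inert in `K`, and
every prime whose square divides `N` splits in `K`, then there exist integers
`a, b` with `gcd(N,a,b) = 1` and `a² - 4Nb = Dc²`.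
-/

/-- A rational prime `p` splits in `K`: `p𝒪_K` is a product of two distinct primes. -/
def Nat.SplitsIn (p : ℕ) (K : Type*) [Field K] [NumberField K] : Prop :=
  ∃ P Q : Ideal (NumberField.RingOfIntegers K), P ≠ Q ∧ P.IsPrime ∧ Q.IsPrime ∧
    Ideal.span {(p : NumberField.RingOfIntegers K)} = P * Q

/-- A rational prime `p` is inert in `K`: `p𝒪_K` is a prime ideal. -/
def Nat.InertIn (p : ℕ) (K : Type*) [Field K] [NumberField K] : Prop :=
  (Ideal.span {(p : NumberField.RingOfIntegers K)}).IsPrime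

open Polynomial NumberField

namespace Polynomial

/-- A polynomial over `ℤ` with a root modulo each prime power dividing `N` has a root
modulo `N`. -/
theorem exists_natCast_dvd_eval_of_prime_pow (f : ℤ[X]) (N : ℕ) (hN : N ≠ 0)
    (h : ∀ p k : ℕ, p.Prime → p ^ k ∣ N → ∃ r : ℤ, ((p ^ k : ℕ) : ℤ) ∣ f.eval r) :
    ∃ r : ℤ, (N : ℤ) ∣ f.eval r := by
  induction N using Nat.recOnPosPrimePosCoprime with
  | prime_pow p n hp _ => exact h p n hp dvd_rfl
  | zero => exact absurd rfl hN
  | one => exact ⟨0, by simp⟩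
  | coprime a b _ _ hab iha ihb =>
    obtain ⟨r, hr⟩ := iha (by lia) fun p k hp hk => h p k hp (hk.mul_right b)
    obtain ⟨s, hs⟩ := ihb (by lia) fun p k hp hk => h p k hp (hk.mul_left a)
    have hab' : IsCoprime (a : ℤ) b := Nat.isCoprime_iff_coprime.mpr hab
    have ⟨u, v, huv⟩ := hab'
    refine ⟨s * (u * a) + r * (v * b), ?_⟩
    rw [Nat.cast_mul]
    refine hab'.mul_dvd ?_ ?_
    · refine (dvd_iff_dvd_of_dvd_sub (dvd_trans ?_ (sub_dvd_eval_sub _ r f))).mpr hr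
      exact ⟨(s - r) * u, by linear_combination r * huv⟩
    · refine (dvd_iff_dvd_of_dvd_sub (dvd_trans ?_ (sub_dvd_eval_sub _ s f))).mpr hs
      exact ⟨(r - s) * v, by linear_combination s * huv⟩

/-- A simple root modulo a prime `p` lifts to a root modulo every power of `p`. -/
theorem exists_prime_pow_dvd_eval (f : ℤ[X]) {p : ℤ} (hp : Prime p) {r : ℤ}
    (hr : p ∣ f.eval r) (hr' : ¬ p ∣ f.derivative.eval r) (k : ℕ) :
    ∃ s : ℤ, p ^ k ∣ f.eval s := by
  suffices ∃ s : ℤ, p ^ (k + 1) ∣ f.eval s ∧ ¬ p ∣ f.derivative.eval s by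
    obtain ⟨s, hs, -⟩ := this
    exact ⟨s, (pow_dvd_pow p k.le_succ).trans hs⟩
  induction k with
  | zero => exact ⟨r, by simpa using hr, hr'⟩
  | succ k ih =>
    obtain ⟨s, ⟨m, hm⟩, hs'⟩ := ih
    obtain ⟨u, v, huv⟩ := (hp.irreducible.coprime_iff_not_dvd).mpr hs'
    obtain ⟨w, hw⟩ := f.binomExpansion s (p ^ (k + 1) * (-m * v))
    refine ⟨s + p ^ (k + 1) * (-m * v), ?_, fun h => hs' ?_⟩
    · rw [hw, hm]
      exact ⟨m * u + w * p ^ k * (m * v) ^ 2, by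
        linear_combination (-(p ^ (k + 1) * m)) * huv⟩
    · refine (dvd_iff_dvd_of_dvd_sub (dvd_trans ?_ (sub_dvd_eval_sub _ s f.derivative))).mp h
      exact ⟨p ^ k * (-m * v), by ring⟩

end Polynomial

namespace Module.Basis

variable {R : Type*} [CommRing R] {b : Module.Basis (Fin 2) ℤ R}

theorem intCast_dvd_add_mul_iff (hb : b 0 = 1) (m x y : ℤ) :
    (m : R) ∣ x + y * b 1 ↔ m ∣ x ∧ m ∣ y := by
  constructor
  · rintro ⟨z, hz⟩
    have h := congrArg b.repr (show x • b 0 + y • b 1 = m • z by simpa [hb] using hz)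
    simp only [map_add, map_zsmul, b.repr_self] at h
    have h0 := DFunLike.congr_fun h 0
    have h1 := DFunLike.congr_fun h 1
    simp at h0 h1
    exact ⟨⟨_, h0⟩, ⟨_, h1⟩⟩
  · rintro ⟨⟨x', rfl⟩, ⟨y', rfl⟩⟩
    exact ⟨x' + y' * b 1, by push_cast; ring⟩

theorem exists_eq_add_mul (hb : b 0 = 1) (z : R) : ∃ x y : ℤ, z = x + y * b 1 :=
  ⟨b.repr z 0, b.repr z 1, by simpa [Fin.sum_univ_two, hb] using (b.sum_repr z).symm⟩

theorem not_natCast_prime_dvd_sub (hb : b 0 = 1) {p : ℕ} (hp : p.Prime) (r : ℤ) :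
    ¬ (p : R) ∣ b 1 - r := fun h => by
  have := (b.intCast_dvd_add_mul_iff hb p (-r) 1).mp (by
    push_cast; rwa [one_mul, neg_add_eq_sub])
  exact (Nat.prime_iff_prime_int.mp hp).not_dvd_one this.2

end Module.Basis

namespace NumberField

variable {K : Type*} [Field K] [NumberField K]

theorem RingOfIntegers.natCast_prime_not_dvd_one {p : ℕ} (hp : p.Prime) :
    ¬ (p : 𝓞 K) ∣ 1 := by
  rintro ⟨x, hx⟩
  have hpK : (p : ℚ) ≠ 0 := by exact_mod_cast hp.ne_zero
  have hx' : (x : K) = algebraMap ℚ K (p : ℚ)⁻¹ := by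
    have := congrArg (algebraMap (𝓞 K) K) hx
    rw [map_one, map_mul, map_natCast] at this
    rw [map_inv₀, map_natCast]
    exact eq_inv_of_mul_eq_one_right this.symm
  have hint : IsIntegral ℤ (p : ℚ)⁻¹ := by
    rw [← isIntegral_algebraMap_iff (algebraMap ℚ K).injective, ← hx']
    exact x.isIntegral_coe
  obtain ⟨m, hm⟩ := IsIntegrallyClosed.isIntegral_iff.mp hint
  have : (p : ℤ) * m = 1 := by
    have h : (p : ℚ) * m = 1 := by
      rw [show (m : ℚ) = (p : ℚ)⁻¹ from hm, mul_inv_cancel₀ hpK]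
    exact_mod_cast h
  exact (Nat.prime_iff_prime_int.mp hp).not_dvd_one ⟨m, this.symm⟩

/-- The ring of integers of a quadratic field has an integral basis `1, ω`. -/
theorem exists_basis_one_of_finrank_eq_two (hdeg : Module.finrank ℚ K = 2) :
    ∃ b : Module.Basis (Fin 2) ℤ (𝓞 K), b 0 = 1 := by
  have hrank : Module.finrank ℤ (𝓞 K) = 2 := by rw [RingOfIntegers.rank, hdeg]
  let e := Module.finBasisOfFinrankEq ℤ (𝓞 K) hrank
  have he : e.repr 1 0 • e 0 + e.repr 1 1 • e 1 = 1 := by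
    simpa [Fin.sum_univ_two] using e.sum_repr 1
  set x := e.repr 1 0
  set y := e.repr 1 1
  have hxy : IsCoprime x y := by
    rw [Int.isCoprime_iff_gcd_eq_one]
    by_contra h
    obtain ⟨p, hp, hpd⟩ := Nat.exists_prime_and_dvd h
    obtain ⟨hpx, hpy⟩ := Int.dvd_coe_gcd_iff.mp (Int.natCast_dvd_natCast.mpr hpd)
    obtain ⟨x', hx'⟩ := hpx
    obtain ⟨y', hy'⟩ := hpy
    refine RingOfIntegers.natCast_prime_not_dvd_one (K := K) hp ⟨x' • e 0 + y' • e 1, ?_⟩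
    rw [← he, hx', hy']
    simp only [zsmul_eq_mul]
    push_cast
    ring
  obtain ⟨u, v, huv⟩ := hxy
  have huv' : (u : 𝓞 K) * x + v * y = 1 := by exact_mod_cast huv
  simp only [zsmul_eq_mul] at he
  let ω : 𝓞 K := -v * e 0 + u * e 1
  have h0 : e 0 ∈ Submodule.span ℤ (Set.range ![1, ω]) := by
    refine Submodule.mem_span_range_iff_exists_fun ℤ |>.mpr ⟨![u, -y], ?_⟩
    simp only [Fin.sum_univ_two, Matrix.cons_val_zero, Matrix.cons_val_one, zsmul_eq_mul, ω]
    push_cast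
    linear_combination (-(u : 𝓞 K)) * he + e 0 * huv'
  have h1 : e 1 ∈ Submodule.span ℤ (Set.range ![1, ω]) := by
    refine Submodule.mem_span_range_iff_exists_fun ℤ |>.mpr ⟨![v, x], ?_⟩
    simp only [Fin.sum_univ_two, Matrix.cons_val_zero, Matrix.cons_val_one, zsmul_eq_mul, ω]
    linear_combination (-(v : 𝓞 K)) * he + e 1 * huv'
  have hspan : ⊤ ≤ Submodule.span ℤ (Set.range ![1, ω]) := by
    rw [← e.span_eq, Submodule.span_le]
    rintro _ ⟨i, rfl⟩
    fin_cases i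
    exacts [h0, h1]
  exact ⟨basisOfTopLeSpanOfCardEqFinrank ![1, ω] hspan (by simp [hrank]), by simp⟩

section Quadratic

variable {b : Module.Basis (Fin 2) ℤ (𝓞 K)} {t n : ℤ}

theorem discr_eq_of_basis_one (hb : b 0 = 1) (hω : b 1 ^ 2 - t * b 1 + n = 0) :
    discr K = t ^ 2 - 4 * n := by
  have hrepr (x y : ℤ) :
      b.repr ((x : 𝓞 K) + y * b 1) = Finsupp.single 0 x + Finsupp.single 1 y := by
    rw [show (x : 𝓞 K) + y * b 1 = x • b 0 + y • b 1 by simp [hb], map_add, map_zsmul, map_zsmul,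
      b.repr_self, b.repr_self]
    simp
  have htrace (x y : ℤ) : Algebra.trace ℤ (𝓞 K) ((x : 𝓞 K) + y * b 1) = 2 * x + t * y := by
    rw [Algebra.trace_eq_matrix_trace b, Matrix.trace_fin_two, Algebra.leftMulMatrix_eq_repr_mul,
      Algebra.leftMulMatrix_eq_repr_mul, hb, mul_one, hrepr,
      show ((x : 𝓞 K) + y * b 1) * b 1 = ((-n * y : ℤ) : 𝓞 K) + ((x + t * y : ℤ) : 𝓞 K) * b 1 by
        push_cast; linear_combination (y : 𝓞 K) * hω, hrepr]
    simp
    ring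
  rw [← discr_eq_discr K b, Algebra.discr_def, Matrix.det_fin_two]
  simp only [Algebra.traceMatrix_apply, Algebra.traceForm_apply, hb, one_mul, mul_one]
  have h1 := htrace 1 0
  have h2 := htrace 0 1
  have h3 := htrace (-n) t
  rw [show ((-n : ℤ) : 𝓞 K) + (t : 𝓞 K) * b 1 = b 1 * b 1 by
    push_cast; linear_combination -hω] at h3
  simp only [Int.cast_one, Int.cast_zero, zero_mul, add_zero, zero_add, one_mul] at h1 h2
  rw [h1, h2, h3]
  ring

/-- If `p` is not inert, the minimal polynomial of `ω` has a root modulo `p`. -/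
theorem exists_dvd_of_not_inertIn (hb : b 0 = 1) (hω : b 1 ^ 2 - t * b 1 + n = 0)
    {p : ℕ} (hp : p.Prime) (h : ¬ p.InertIn K) : ∃ r : ℤ, (p : ℤ) ∣ r ^ 2 - t * r + n := by
  by_contra! hr
  have hpZ := Nat.prime_iff_prime_int.mp hp
  have key (x y : ℤ) (hxy : (p : ℤ) ∣ x ^ 2 + t * x * y + n * y ^ 2) :
      (p : 𝓞 K) ∣ x + y * b 1 := by
    rw [← Int.cast_natCast, b.intCast_dvd_add_mul_iff hb]
    by_cases hy : (p : ℤ) ∣ y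
    · refine ⟨hpZ.dvd_of_dvd_pow (n := 2) ?_, hy⟩
      obtain ⟨y', rfl⟩ := hy
      obtain ⟨m, hm⟩ := hxy
      exact ⟨m - t * x * y' - n * p * y' ^ 2, by linear_combination hm⟩
    · obtain ⟨u, v, huv⟩ := hpZ.irreducible.coprime_iff_not_dvd.mpr hy
      obtain ⟨m, hm⟩ := hxy
      refine absurd ?_ (hr (-x * v))
      exact ⟨v ^ 2 * m + t * x * v * u + n * u * (1 + v * y), by
        linear_combination v ^ 2 * hm - (t * x * v + n * (1 + v * y)) * huv⟩
  refine h ?_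
  have hp0 : (p : 𝓞 K) ≠ 0 := by exact_mod_cast hp.ne_zero
  rw [Nat.InertIn, Ideal.span_singleton_prime hp0]
  refine ⟨hp0, fun hu => RingOfIntegers.natCast_prime_not_dvd_one hp (isUnit_iff_dvd_one.mp hu), ?_⟩
  intro α β hαβ
  obtain ⟨x, y, rfl⟩ := b.exists_eq_add_mul hb α
  obtain ⟨z, w, rfl⟩ := b.exists_eq_add_mul hb β
  rw [show ((x : 𝓞 K) + y * b 1) * (z + w * b 1) =
      ((x * z - n * y * w : ℤ) : 𝓞 K) + ((x * w + y * z + t * y * w : ℤ) : 𝓞 K) * b 1 by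
    push_cast; linear_combination (y : 𝓞 K) * w * hω, ← Int.cast_natCast,
    b.intCast_dvd_add_mul_iff hb] at hαβ
  obtain ⟨⟨k, hk⟩, ⟨l, hl⟩⟩ := hαβ
  refine (hpZ.dvd_or_dvd (a := x ^ 2 + t * x * y + n * y ^ 2)
    (b := z ^ 2 + t * z * w + n * w ^ 2) ?_).imp (key x y) (key z w)
  have e : (x ^ 2 + t * x * y + n * y ^ 2) * (z ^ 2 + t * z * w + n * w ^ 2) =
      (x * z - n * y * w) ^ 2 + t * (x * z - n * y * w) * (x * w + y * z + t * y * w)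
        + n * (x * w + y * z + t * y * w) ^ 2 := by ring
  rw [e, hk, hl]
  exact ⟨p * k ^ 2 + t * k * p * l + n * p * l ^ 2, by ring⟩

/-- If `p` splits, every root modulo `p` of the minimal polynomial of `ω` is simple. -/
theorem not_dvd_of_splitsIn (hb : b 0 = 1) (hω : b 1 ^ 2 - t * b 1 + n = 0)
    {p : ℕ} (hp : p.Prime) (h : p.SplitsIn K) {r : ℤ} (hr : (p : ℤ) ∣ r ^ 2 - t * r + n) :
    ¬ (p : ℤ) ∣ 2 * r - t := by
  rintro ⟨l, hl⟩
  obtain ⟨m, hm⟩ := hr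
  obtain ⟨P, Q, hPQ, hP, hQ, hpPQ⟩ := h
  have hp0 : (p : 𝓞 K) ≠ 0 := by exact_mod_cast hp.ne_zero
  have hne : P * Q ≠ ⊥ := by rwa [← hpPQ, Ne, Ideal.span_singleton_eq_bot]
  have hPmax := hP.isMaximal (left_ne_zero_of_mul hne)
  have hQmax := hQ.isMaximal (right_ne_zero_of_mul hne)
  have hinf : Ideal.span {(p : 𝓞 K)} = P ⊓ Q := by
    rw [hpPQ, Ideal.mul_eq_inf_of_isCoprime (Ideal.isCoprime_of_isMaximal hPQ)]
  have hsq : (b 1 - (r : 𝓞 K)) ^ 2 ∈ P ⊓ Q := by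
    rw [← hinf, Ideal.mem_span_singleton]
    have hl' : 2 * (r : 𝓞 K) - t = p * l := by exact_mod_cast congrArg (Int.cast (R := 𝓞 K)) hl
    have hm' : (r : 𝓞 K) ^ 2 - t * r + n = p * m := by
      exact_mod_cast congrArg (Int.cast (R := 𝓞 K)) hm
    exact ⟨-(l * (b 1 - r)) - m, by linear_combination hω - (b 1 - r) * hl' - hm'⟩
  refine b.not_natCast_prime_dvd_sub hb hp r ?_
  rw [← Ideal.mem_span_singleton, hinf]
  exact ⟨hP.mem_of_pow_mem 2 hsq.1, hQ.mem_of_pow_mem 2 hsq.2⟩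

/-- Since `ℤ[ω]` is integrally closed, a root modulo `p ^ 2` of the minimal polynomial of `ω`
is a simple root modulo `p`. -/
theorem not_dvd_of_sq_dvd (hb : b 0 = 1) (hω : b 1 ^ 2 - t * b 1 + n = 0)
    {p : ℕ} (hp : p.Prime) {r : ℤ} (hr : (p : ℤ) ^ 2 ∣ r ^ 2 - t * r + n) :
    ¬ (p : ℤ) ∣ 2 * r - t := by
  rintro ⟨l, hl⟩
  obtain ⟨m, hm⟩ := hr
  refine b.not_natCast_prime_dvd_sub hb hp r ?_
  have hpK : (p : K) ≠ 0 := by exact_mod_cast hp.ne_zero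
  have hl' : 2 * (r : K) - t = p * l := by exact_mod_cast congrArg (Int.cast (R := K)) hl
  have hm' : (r : K) ^ 2 - t * r + n = p ^ 2 * m := by
    exact_mod_cast congrArg (Int.cast (R := K)) hm
  have hω' : (b 1 : K) ^ 2 - t * b 1 + n = 0 := by
    simpa using congrArg (algebraMap (𝓞 K) K) hω
  have hint : IsIntegral ℤ (((b 1 : K) - r) / p) := by
    refine ⟨X ^ 2 + C l * X + C m, by monicity!, ?_⟩
    simp only [eval₂_add, eval₂_mul, eval₂_pow, eval₂_X, eval₂_C, algebraMap_int_eq, Int.coe_castRingHom]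
    field_simp
    linear_combination hω' - ((b 1 : K) - r) * hl' - hm'
  obtain ⟨z, hz⟩ : ∃ z : 𝓞 K, (z : K) = ((b 1 : K) - r) / p := ⟨⟨_, hint⟩, rfl⟩
  refine ⟨z, RingOfIntegers.ext ?_⟩
  rw [RingOfIntegers.coe_eq_algebraMap] at hz
  simp [hz, mul_div_cancel₀ _ hpK]

end Quadratic

end NumberField

theorem heegner_condition_gives_binary_form
    (K : Type*) [Field K] [NumberField K]
    (himag : ∀ v : NumberField.InfinitePlace K, v.IsComplex)
    (hdeg : Module.finrank ℚ K = 2)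
    (D : ℤ) (hD : D = NumberField.discr K)
    (N c : ℕ) (hN : 1 ≤ N) (hc : 1 ≤ c) (hcN : Nat.gcd c N = 1)
    (hnotinert : ∀ p : ℕ, p.Prime → p ∣ N → ¬ p.InertIn K)
    (hsplit : ∀ p : ℕ, p.Prime → p ^ 2 ∣ N → p.SplitsIn K) :
    ∃ a b : ℤ, Int.gcd (N : ℤ) (Int.gcd a b) = 1 ∧
      a ^ 2 - 4 * N * b = D * c ^ 2 := by
  obtain ⟨e, he⟩ := exists_basis_one_of_finrank_eq_two hdeg
  obtain ⟨x, y, hxy⟩ := e.exists_eq_add_mul he (e 1 ^ 2)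
  obtain ⟨t, n, hω⟩ : ∃ t n : ℤ, e 1 ^ 2 - t * e 1 + n = 0 :=
    ⟨y, -x, by push_cast; linear_combination hxy⟩
  let f : ℤ[X] := X ^ 2 - C t * X + C n
  have hf (r : ℤ) : f.eval r = r ^ 2 - t * r + n := by simp [f]
  have hf' (r : ℤ) : f.derivative.eval r = 2 * r - t := by simp [f]
  obtain ⟨r, s, hs⟩ : ∃ r : ℤ, (N : ℤ) ∣ f.eval r := by
    refine f.exists_natCast_dvd_eval_of_prime_pow N (by lia) fun p k hp hk => ?_
    rcases k.eq_zero_or_pos with rfl | hk0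
    · exact ⟨0, by simp⟩
    obtain ⟨r, hr⟩ := exists_dvd_of_not_inertIn he hω hp
      (hnotinert p hp ((dvd_pow_self p hk0.ne').trans hk))
    rcases (show k = 1 ∨ 2 ≤ k by lia) with rfl | hk2
    · exact ⟨r, by rwa [hf, pow_one]⟩
    · have hr' := not_dvd_of_splitsIn he hω hp (hsplit p hp ((pow_dvd_pow p hk2).trans hk)) hr
      rw [Nat.cast_pow]
      exact f.exists_prime_pow_dvd_eval (Nat.prime_iff_prime_int.mp hp) (hf r ▸ hr)
        (by rwa [hf']) k
  rw [hf] at hs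
  refine ⟨(2 * r - t) * c, s * c ^ 2, ?_, ?_⟩
  · by_contra hgcd
    obtain ⟨p, hp, hpd⟩ := Nat.exists_prime_and_dvd hgcd
    have hpZ := Nat.prime_iff_prime_int.mp hp
    obtain ⟨hpN, hpab⟩ := Int.dvd_coe_gcd_iff.mp (Int.natCast_dvd_natCast.mpr hpd)
    obtain ⟨hpa, hpb⟩ := Int.dvd_coe_gcd_iff.mp hpab
    have hpc : ¬ (p : ℤ) ∣ c := fun h => hp.one_lt.ne' <| Nat.dvd_one.mp <|
      hcN ▸ Nat.dvd_gcd (Int.natCast_dvd_natCast.mp h) (Int.natCast_dvd_natCast.mp hpN)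
    refine not_dvd_of_sq_dvd he hω hp (r := r) ?_ ((hpZ.dvd_or_dvd hpa).resolve_right hpc)
    rw [hs, pow_two]
    exact mul_dvd_mul hpN ((hpZ.dvd_or_dvd hpb).resolve_right
      fun h => hpc (hpZ.dvd_of_dvd_pow h))
  · rw [hD, discr_eq_of_basis_one he hω]
    linear_combination 4 * (c : ℤ) ^ 2 * hs
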